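/- Let D ⊂ ℝ² be a bounded open set with smooth boundary, and let w be a smooth function on a neighborhood of the closure of D such that R[w] := −2e^{−2w}Δw > 0 on the closure of D. Assume λ₁(D,w) > sup_{x ∈ D} R[w](x). Let u be a smooth function on the closure of D such that: (i) −2e^{−2(w+u)}·Δ(w+u) ≥ −2e^{−2w}·Δw at every point of D (i.e. the scalar curvature of e^{2(w+u)}·δ is ≥ that of e^{2w}·δ); (ii) u = 0 on ∂D; (iii) ∂u/∂ν = 0 on ∂D, where ν is the outward unit normal. Then u ≡ 0 on D. -/

import Mathlib

open MeasureTheory Real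

/-- The Euclidean Laplacian of a function `u : ℝ² → ℝ`. -/
noncomputable def lap (u : EuclideanSpace ℝ (Fin 2) → ℝ)
    (x : EuclideanSpace ℝ (Fin 2)) : ℝ :=
  ∑ i : Fin 2, fderiv ℝ (fun y => fderiv ℝ u y (EuclideanSpace.single i 1)) x
    (EuclideanSpace.single i 1)

/-- The scalar curvature `R[W] = -2 e^{-2W} ΔW` of the conformally flat metric
`e^{2W}·δ` on an open set of `ℝ²`. -/
noncomputable def Rcurv2 (W : EuclideanSpace ℝ (Fin 2) → ℝ)
    (x : EuclideanSpace ℝ (Fin 2)) : ℝ :=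
  -2 * Real.exp (-2 * W x) * lap W x

/-- `D` has smooth boundary, with outward unit normal field `ν` on `∂D`. -/
def SmoothBoundaryNormal (D : Set (EuclideanSpace ℝ (Fin 2)))
    (ν : EuclideanSpace ℝ (Fin 2) → EuclideanSpace ℝ (Fin 2)) : Prop :=
  ∃ f : EuclideanSpace ℝ (Fin 2) → ℝ, ContDiff ℝ (⊤ : ℕ∞) f ∧
    D = {x | f x < 0} ∧ frontier D = {x | f x = 0} ∧
    ∀ x ∈ frontier D, gradient f x ≠ 0 ∧ ν x = ‖gradient f x‖⁻¹ • gradient f x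

/-- The first Dirichlet eigenvalue `λ₁(D, w)` of the Laplace–Beltrami operator of the
metric `e^{2w}·δ` on `D ⊂ ℝ²`, as the infimum of the Rayleigh quotient over nonzero
smooth compactly supported test functions in `D`. -/
noncomputable def lam1 (D : Set (EuclideanSpace ℝ (Fin 2)))
    (w : EuclideanSpace ℝ (Fin 2) → ℝ) : ℝ :=
  sInf { q : ℝ | ∃ φ : EuclideanSpace ℝ (Fin 2) → ℝ, ContDiff ℝ (⊤ : ℕ∞) φ ∧
    HasCompactSupport φ ∧ tsupport φ ⊆ D ∧ φ ≠ 0 ∧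
    q = (∫ x in D, ‖gradient φ x‖ ^ 2) /
        (∫ x in D, Real.exp (2 * w x) * (φ x) ^ 2) }

open Set Filter Topology
open scoped ContDiff

local notation "E₂" => EuclideanSpace ℝ (Fin 2)

section Calculus

/-- A function that is smooth near a closed set agrees near it with a globally smooth one. -/
lemma exists_contDiff_eventuallyEq {K V : Set E₂} (hK : IsClosed K) (hV : IsOpen V)
    (hKV : K ⊆ V) {u : E₂ → ℝ} (hu : ContDiffOn ℝ ∞ u V) :
    ∃ v : E₂ → ℝ, ContDiff ℝ ∞ v ∧ ∀ x ∈ K, v =ᶠ[𝓝 x] u := by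
  obtain ⟨χ, hχ0, hχ1, -⟩ := exists_contMDiffMap_zero_one_nhds_of_isClosed (n := ⊤)
    (modelWithCornersSelf ℝ E₂) hV.isClosed_compl hK
    (Set.disjoint_left.2 fun x hx hxK => hx (hKV hxK))
  have hχ : ContDiff ℝ ∞ χ := χ.contMDiff.contDiff
  refine ⟨fun x => χ x * u x, contDiff_iff_contDiffAt.2 fun x => ?_, fun x hx => ?_⟩
  · by_cases hx : x ∈ V
    · exact hχ.contDiffAt.mul (hu.contDiffAt (hV.mem_nhds hx))
    · have h := eventually_nhdsSet_iff_forall.1 hχ0 x hx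
      refine (contDiffAt_const (c := (0 : ℝ))).congr_of_eventuallyEq ?_
      filter_upwards [h] with y hy
      simp [hy]
  · filter_upwards [eventually_nhdsSet_iff_forall.1 hχ1 x hx] with y hy
    simp [hy]

lemma lap_congr {u v : E₂ → ℝ} {x : E₂} (h : u =ᶠ[𝓝 x] v) : lap u x = lap v x := by
  unfold lap
  refine Finset.sum_congr rfl fun i _ => ?_
  have h' : (fun y => fderiv ℝ u y (EuclideanSpace.single i 1)) =ᶠ[𝓝 x]
      fun y => fderiv ℝ v y (EuclideanSpace.single i 1) := by
    filter_upwards [h.fderiv (𝕜 := ℝ)] with y hy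
    rw [hy]
  rw [h'.fderiv_eq]

lemma contDiff_fderiv_apply {u : E₂ → ℝ} (hu : ContDiff ℝ ∞ u) (v : E₂) :
    ContDiff ℝ ∞ fun x => fderiv ℝ u x v :=
  (hu.fderiv_right (m := ∞) (by simp)).clm_apply contDiff_const

lemma continuous_lap {u : E₂ → ℝ} (hu : ContDiff ℝ ∞ u) : Continuous (lap u) := by
  unfold lap
  exact continuous_finsetSum _ fun i _ =>
    (contDiff_fderiv_apply (contDiff_fderiv_apply hu _) _).continuous

lemma lap_add {u v : E₂ → ℝ} (hu : ContDiff ℝ ∞ u) (hv : ContDiff ℝ ∞ v) (x : E₂) :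
    lap (fun y => u y + v y) x = lap u x + lap v x := by
  unfold lap
  rw [← Finset.sum_add_distrib]
  refine Finset.sum_congr rfl fun i _ => ?_
  have h : (fun y => fderiv ℝ (fun y => u y + v y) y (EuclideanSpace.single i 1)) =
      fun y => fderiv ℝ u y (EuclideanSpace.single i 1) +
        fderiv ℝ v y (EuclideanSpace.single i 1) := by
    funext y
    rw [fderiv_fun_add (hu.differentiable (by simp) y) (hv.differentiable (by simp) y)]
    rfl
  rw [h, fderiv_fun_add ((contDiff_fderiv_apply hu _).differentiable (by simp) x)
    ((contDiff_fderiv_apply hv _).differentiable (by simp) x)]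
  rfl

lemma lap_neg (u : E₂ → ℝ) (x : E₂) : lap (fun y => -u y) x = -lap u x := by
  simp [lap, fderiv_fun_neg, Finset.sum_neg_distrib]

lemma Rcurv2_mul_exp (W : E₂ → ℝ) (x : E₂) :
    Rcurv2 W x * Real.exp (2 * W x) = -2 * lap W x := by
  rw [Rcurv2, mul_right_comm, mul_assoc (-2 : ℝ), ← Real.exp_add]
  simp

lemma norm_gradient_sq (φ : E₂ → ℝ) (x : E₂) :
    ‖gradient φ x‖ ^ 2 = ∑ i : Fin 2, fderiv ℝ φ x (EuclideanSpace.single i 1) ^ 2 := by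
  rw [EuclideanSpace.norm_sq_eq]
  refine Finset.sum_congr rfl fun i _ => ?_
  rw [← inner_gradient_left, EuclideanSpace.inner_single_right]
  simp

lemma fderiv_gradient_eq_sum (u f : E₂ → ℝ) (x : E₂) :
    fderiv ℝ u x (gradient f x) = ∑ i : Fin 2,
      fderiv ℝ f x (EuclideanSpace.single i 1) * fderiv ℝ u x (EuclideanSpace.single i 1) := by
  rw [← inner_gradient_left, PiLp.inner_apply]
  refine Finset.sum_congr rfl fun i _ => ?_
  rw [← inner_gradient_left, ← inner_gradient_left, EuclideanSpace.inner_single_right,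
    EuclideanSpace.inner_single_right]
  simp

end Calculus

section Indicator

variable {D : Set (EuclideanSpace ℝ (Fin 2))} {g : EuclideanSpace ℝ (Fin 2) → ℝ}

lemma indicator_eventuallyEq_zero (hg : ∀ x ∈ frontier D, g =ᶠ[𝓝 x] 0) (hDo : IsOpen D)
    {x : E₂} (hx : x ∉ D) : D.indicator g =ᶠ[𝓝 x] 0 := by
  by_cases hxc : x ∈ closure D
  · filter_upwards [hg x (by rw [hDo.frontier_eq]; exact ⟨hxc, hx⟩)] with y hy
    by_cases hyD : y ∈ D <;> simp [hyD, hy]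
  · filter_upwards [isClosed_closure.isOpen_compl.mem_nhds hxc] with y hy
    exact indicator_of_notMem (fun h => hy (subset_closure h)) g

lemma indicator_eventuallyEq_self (hDo : IsOpen D) {x : E₂} (hx : x ∈ D) :
    D.indicator g =ᶠ[𝓝 x] g := by
  filter_upwards [hDo.mem_nhds hx] with y hy
  exact indicator_of_mem hy g

lemma contDiff_indicator (hDo : IsOpen D) (hgs : ContDiff ℝ ∞ g)
    (hg : ∀ x ∈ frontier D, g =ᶠ[𝓝 x] 0) : ContDiff ℝ ∞ (D.indicator g) := by
  refine contDiff_iff_contDiffAt.2 fun x => ?_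
  by_cases hx : x ∈ D
  · exact hgs.contDiffAt.congr_of_eventuallyEq (indicator_eventuallyEq_self hDo hx)
  · exact (contDiffAt_const (c := (0 : ℝ))).congr_of_eventuallyEq
      (indicator_eventuallyEq_zero hg hDo hx)

lemma tsupport_indicator_subset (hDo : IsOpen D) (hg : ∀ x ∈ frontier D, g =ᶠ[𝓝 x] 0) :
    tsupport (D.indicator g) ⊆ D := by
  intro x hx
  by_contra hxD
  exact (notMem_tsupport_iff_eventuallyEq.2 (indicator_eventuallyEq_zero hg hDo hxD)) hx

lemma hasCompactSupport_of_tsupport_subset (hDb : Bornology.IsBounded D)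
    (hg : tsupport g ⊆ D) : HasCompactSupport g :=
  Metric.isCompact_of_isClosed_isBounded (isClosed_tsupport g) (hDb.subset hg)

end Indicator

section Integration

/-- Green's identity against a compactly supported test function. -/
lemma setIntegral_mul_lap {D : Set E₂} {ψ u : E₂ → ℝ} (hψ : ContDiff ℝ ∞ ψ)
    (hψc : HasCompactSupport ψ) (hψD : tsupport ψ ⊆ D) (hu : ContDiff ℝ ∞ u) :
    ∫ x in D, ψ x * lap u x = -∫ x in D, ∑ i : Fin 2,
      fderiv ℝ ψ x (EuclideanSpace.single i 1) * fderiv ℝ u x (EuclideanSpace.single i 1) := by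
  have hψ0 : ∀ x ∉ D, ψ x = 0 := fun x hx => image_eq_zero_of_notMem_tsupport fun h => hx (hψD h)
  have hψ'0 : ∀ x ∉ D, fderiv ℝ ψ x = 0 := fun x hx =>
    fderiv_of_notMem_tsupport ℝ fun h => hx (hψD h)
  rw [setIntegral_eq_integral_of_forall_compl_eq_zero fun x hx => by simp [hψ0 x hx],
    setIntegral_eq_integral_of_forall_compl_eq_zero fun x hx => by simp [hψ'0 x hx]]
  simp only [lap, Finset.mul_sum]
  have hdψ := fun i : Fin 2 => contDiff_fderiv_apply hψ (EuclideanSpace.single i 1)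
  have hdu := fun i : Fin 2 => contDiff_fderiv_apply hu (EuclideanSpace.single i 1)
  have hddu := fun i : Fin 2 => contDiff_fderiv_apply (hdu i) (EuclideanSpace.single i 1)
  have hl : ∀ i : Fin 2, Integrable fun x => ψ x *
      fderiv ℝ (fun y => fderiv ℝ u y (EuclideanSpace.single i 1)) x
        (EuclideanSpace.single i 1) := fun i =>
    (hψ.continuous.mul (hddu i).continuous).integrable_of_hasCompactSupport hψc.mul_right
  have hr : ∀ i : Fin 2, Integrable fun x => fderiv ℝ ψ x (EuclideanSpace.single i 1) *
      fderiv ℝ u x (EuclideanSpace.single i 1) := fun i =>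
    ((hdψ i).continuous.mul (hdu i).continuous).integrable_of_hasCompactSupport
      (hψc.fderiv_apply ℝ _).mul_right
  rw [integral_finsetSum _ fun i _ => hl i, integral_finsetSum _ fun i _ => hr i,
    ← Finset.sum_neg_distrib]
  refine Finset.sum_congr rfl fun i _ => ?_
  exact integral_mul_fderiv_eq_neg_fderiv_mul_of_integrable (hr i) (hl i)
    ((hψ.continuous.mul (hdu i).continuous).integrable_of_hasCompactSupport hψc.mul_right)
    (fun x _ => hψ.differentiable (by simp) x) fun x _ => (hdu i).differentiable (by simp) x

/-- A nonnegative continuous function with zero integral over an open set vanishes there. -/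
lemma eqOn_zero_of_setIntegral_eq_zero {D : Set E₂} (hDo : IsOpen D) {g : E₂ → ℝ}
    (hg : ContinuousOn g D) (hg0 : ∀ x ∈ D, 0 ≤ g x) (hgi : IntegrableOn g D)
    (h : ∫ x in D, g x = 0) : ∀ x ∈ D, g x = 0 := by
  have h0 := (setIntegral_eq_zero_iff_of_nonneg_ae
    (ae_restrict_of_forall_mem hDo.measurableSet hg0) hgi).1 h
  exact fun x hx => Measure.eqOn_open_of_ae_eq h0 hDo hg continuousOn_const hx

end Integration

section Truncation

/-- The primitive of a smooth `[0, 1]`-valued function vanishing on `(-∞, ε]`. -/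
lemma exists_primitive {g : ℝ → ℝ} (hg : ContDiff ℝ ∞ g) (hg0 : ∀ t, 0 ≤ g t)
    (hg1 : ∀ t, g t ≤ 1) {ε : ℝ} (hε : 0 < ε) (hgε : ∀ t ≤ ε, g t = 0) :
    ∃ G : ℝ → ℝ, ContDiff ℝ ∞ G ∧ (∀ s, HasDerivAt G (g s) s) ∧ (∀ s ≤ ε, G s = 0) ∧
      (∀ s, 0 ≤ G s) ∧ ∀ s, G s ≤ max s 0 := by
  have hd : ∀ s, HasDerivAt (fun s => ∫ t in (0 : ℝ)..s, g t) (g s) s := fun s =>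
    intervalIntegral.integral_hasDerivAt_right (hg.continuous.intervalIntegrable _ _)
      (hg.continuous.stronglyMeasurableAtFilter _ _) hg.continuous.continuousAt
  have hz : ∀ s ≤ ε, ∫ t in (0 : ℝ)..s, g t = 0 := by
    intro s hs
    rw [intervalIntegral.integral_congr (g := fun _ => 0)]
    · simp
    · intro t ht
      rcases mem_uIcc.1 ht with ht | ht
      · exact hgε t (by linarith)
      · exact hgε t (by linarith)
  refine ⟨_, contDiff_infty_iff_deriv.2 ⟨fun s => (hd s).differentiableAt, ?_⟩, hd, hz,
    fun s => ?_, fun s => ?_⟩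
  · rwa [funext fun s => (hd s).deriv]
  · rcases le_total s ε with hs | hs
    · exact (hz s hs).ge
    · exact intervalIntegral.integral_nonneg (by linarith) fun t _ => hg0 t
  · rcases le_total s ε with hs | hs
    · exact (hz s hs).trans_le (le_max_right _ _)
    · calc ∫ t in (0 : ℝ)..s, g t ≤ ∫ _ in (0 : ℝ)..s, (1 : ℝ) :=
            intervalIntegral.integral_mono_on (by linarith)
              (hg.continuous.intervalIntegrable _ _) (by simp) fun t _ => hg1 t
        _ = s := by simp
        _ ≤ _ := le_max_left _ _

/-- Smooth approximations `G` of the positive part, paired with `H` such that `H' = G'²`. -/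
lemma exists_smooth_truncation {ε : ℝ} (hε : 0 < ε) :
    ∃ G H g : ℝ → ℝ, ContDiff ℝ ∞ G ∧ ContDiff ℝ ∞ H ∧ (∀ s, HasDerivAt G (g s) s) ∧
      (∀ s, HasDerivAt H (g s ^ 2) s) ∧ (∀ s ≤ ε, G s = 0) ∧ (∀ s ≤ ε, H s = 0) ∧
      (∀ s, 0 ≤ G s) ∧ (∀ s, s - 2 * ε ≤ G s) ∧ (∀ s, 0 ≤ H s) ∧ ∀ s, H s ≤ max s 0 := by
  have hg : ContDiff ℝ ∞ fun t => smoothTransition (t / ε - 1) :=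
    smoothTransition.contDiff.comp ((contDiff_id.div_const ε).sub contDiff_const)
  have hgε : ∀ t ≤ ε, smoothTransition (t / ε - 1) = 0 := fun t ht =>
    smoothTransition.zero_of_nonpos (by rw [sub_nonpos, div_le_one hε]; exact ht)
  have hg1 := fun t : ℝ => smoothTransition.le_one (t / ε - 1)
  have hg0 := fun t : ℝ => smoothTransition.nonneg (t / ε - 1)
  obtain ⟨G, hG, hGd, hGε, hG0, hG1⟩ := exists_primitive hg hg0 hg1 hε hgε
  obtain ⟨H, hH, hHd, hHε, hH0, hH1⟩ := exists_primitive (hg.pow 2) (fun t => sq_nonneg _)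
    (fun t => pow_le_one₀ (hg0 t) (hg1 t)) hε fun t ht => by rw [hgε t ht]; simp
  refine ⟨G, H, _, hG, hH, hGd, hHd, hGε, hHε, hG0, fun s => ?_, hH0, hH1⟩
  rcases le_total s (2 * ε) with hs | hs
  · linarith [hG0 s]
  · have hconst : ∀ t ∈ Icc (2 * ε) s, G t - t = G (2 * ε) - 2 * ε := by
      refine constant_of_has_deriv_right_zero
        ((hG.continuous.sub continuous_id).continuousOn) fun t ht => ?_
      have h1 : smoothTransition (t / ε - 1) = 1 :=
        smoothTransition.one_of_one_le (by
          have : 2 ≤ t / ε := by rw [le_div_iff₀ hε]; exact ht.1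
          linarith)
      have := ((hGd t).sub (hasDerivAt_id t)).hasDerivWithinAt (s := Ici t)
      rwa [h1, sub_self] at this
    linarith [hconst s ⟨hs, le_rfl⟩, hG0 (2 * ε)]

end Truncation

section BoundaryEstimate

/-- Near a regular zero of `f`, a `C¹` function vanishing on `{f = 0}` is `O(f)` on `{f < 0}`. -/
lemma exists_abs_le_mul_abs_near {f h : E₂ → ℝ} (hf : ContDiff ℝ ∞ f) (hh : ContDiff ℝ ∞ h)
    (hh0 : ∀ x, f x = 0 → h x = 0) {p : E₂} (hp : f p = 0) (hgrad : gradient f p ≠ 0) :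
    ∃ C : ℝ, ∀ᶠ x in 𝓝 p, f x < 0 → |h x| ≤ C * |f x| := by
  set v := gradient f p with hv
  have hN : 0 < ‖v‖ := norm_pos_iff.2 hgrad
  have hfv : fderiv ℝ f p v = ‖v‖ ^ 2 := by
    rw [← inner_gradient_left, ← hv, real_inner_self_eq_norm_sq]
  obtain ⟨K, t, ht, hK⟩ := (hh.contDiffAt (x := p)).of_le
    (by simp : (1 : WithTop ℕ∞) ≤ ∞) |>.exists_lipschitzOnWith
  obtain ⟨r, hr, hrt⟩ := Metric.mem_nhds_iff.1 ht
  have hpos : ∀ᶠ y in 𝓝 p, ‖v‖ ^ 2 / 2 < fderiv ℝ f y v :=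
    (contDiff_fderiv_apply hf v).continuous.continuousAt.eventually
      (lt_mem_nhds (by simp only [hfv]; nlinarith))
  obtain ⟨r', hr', hpos'⟩ := Metric.eventually_nhds_iff_ball.1 hpos
  set ρ := min r r'
  have hρ0 : 0 < ρ := lt_min hr hr'
  let T : E₂ → ℝ := fun x => 2 * |f x| / ‖v‖ ^ 2
  have hT : Tendsto (fun x => x + T x • v) (𝓝 p) (𝓝 p) := by
    have : Continuous fun x => x + T x • v := by
      have := hf.continuous
      fun_prop
    simpa [T, hp] using this.tendsto p
  refine ⟨2 * K / ‖v‖, ?_⟩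
  filter_upwards [Metric.ball_mem_nhds p hρ0, hT.eventually (Metric.ball_mem_nhds p hρ0)]
    with x hx hxT hfx
  have hT0 : 0 ≤ T x := by positivity
  have hseg : ∀ s ∈ Icc 0 (T x), x + s • v ∈ Metric.ball p ρ := by
    intro s hs
    rcases hT0.eq_or_lt with h0 | h0
    · have : s = 0 := le_antisymm (h0 ▸ hs.2) hs.1
      simpa [this] using hx
    · refine (convex_ball p ρ).segment_subset hx hxT
        (by
          rw [segment_eq_image']
          refine ⟨s / T x, ⟨div_nonneg hs.1 hT0, div_le_one_of_le₀ hs.2 hT0⟩, ?_⟩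
          simp only [add_sub_cancel_left, smul_smul]
          rw [div_mul_cancel₀ _ h0.ne'])
  have hder : ∀ s, HasDerivAt (fun s : ℝ => f (x + s • v)) (fderiv ℝ f (x + s • v) v) s := by
    intro s
    have h1 : HasDerivAt (fun s : ℝ => x + s • v) v s := by
      simpa using ((hasDerivAt_id s).smul_const v).const_add x
    exact (hf.differentiable (by simp) _).hasFDerivAt.comp_hasDerivAt s h1
  have hcont : Continuous fun s : ℝ => f (x + s • v) :=
    continuous_iff_continuousAt.2 fun s => (hder s).continuousAt
  have hend : 0 ≤ f (x + T x • v) := by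
    have h1 := (convex_Icc (0 : ℝ) (T x)).mul_sub_le_image_sub_of_le_deriv
      hcont.continuousOn (fun s _ => (hder s).differentiableAt.differentiableWithinAt)
      (C := ‖v‖ ^ 2 / 2) (fun s hs => by
        rw [(hder s).deriv]
        rw [interior_Icc] at hs
        exact (hpos' _ (Metric.ball_subset_ball (min_le_right _ _)
          (hseg s (Ioo_subset_Icc_self hs)))).le)
      0 (left_mem_Icc.2 hT0) (T x) (right_mem_Icc.2 hT0) hT0
    have h2 : ‖v‖ ^ 2 / 2 * (T x - 0) = |f x| := by
      simp only [T]
      field_simp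
      ring
    rw [h2, abs_of_neg hfx] at h1
    simp only [zero_smul, add_zero] at h1
    linarith
  obtain ⟨s, hs, hfs⟩ := intermediate_value_Icc hT0 hcont.continuousOn
    (⟨by simpa using hfx.le, hend⟩ : (0 : ℝ) ∈ Icc (f (x + (0 : ℝ) • v)) (f (x + T x • v)))
  have hlip := hK.dist_le_mul x (hrt (Metric.ball_subset_ball (min_le_left _ _) hx)) (x + s • v)
    (hrt (Metric.ball_subset_ball (min_le_left _ _) (hseg s hs)))
  rw [hh0 _ hfs, dist_self_add_right, Real.dist_eq, sub_zero, norm_smul,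
    Real.norm_of_nonneg hs.1] at hlip
  calc |h x| ≤ K * (s * ‖v‖) := hlip
    _ ≤ K * (T x * ‖v‖) := by gcongr; exact hs.2
    _ = 2 * K / ‖v‖ * |f x| := by
      simp only [T]
      field_simp

lemma exists_abs_le_mul_abs {D : Set E₂} (hDb : Bornology.IsBounded D) {f h : E₂ → ℝ}
    (hf : ContDiff ℝ ∞ f) (hD : D = {x | f x < 0}) (hfr : frontier D = {x | f x = 0})
    (hgrad : ∀ x ∈ frontier D, gradient f x ≠ 0) (hh : ContDiff ℝ ∞ h)
    (hh0 : ∀ x ∈ frontier D, h x = 0) : ∃ C : ℝ, 0 ≤ C ∧ ∀ x ∈ D, |h x| ≤ C * |f x| := by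
  rw [hfr] at hgrad hh0
  suffices ∃ C : ℝ, ∀ x ∈ closure D, f x < 0 → |h x| ≤ C * |f x| by
    obtain ⟨C, hC⟩ := this
    refine ⟨max C 0, le_max_right _ _, fun x hx => ?_⟩
    exact (hC x (subset_closure hx) (hD ▸ hx :)).trans
      (mul_le_mul_of_nonneg_right (le_max_left _ _) (abs_nonneg _))
  refine hDb.isCompact_closure.induction_on
    (p := fun s => ∃ C : ℝ, ∀ x ∈ s, f x < 0 → |h x| ≤ C * |f x|) ⟨0, by simp⟩
    (fun s t hst ⟨C, hC⟩ => ⟨C, fun x hx => hC x (hst hx)⟩) ?_ ?_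
  · rintro s t ⟨C, hC⟩ ⟨C', hC'⟩
    refine ⟨max C C', fun x hx hfx => ?_⟩
    rcases hx with hx | hx
    · exact (hC x hx hfx).trans (mul_le_mul_of_nonneg_right (le_max_left _ _) (abs_nonneg _))
    · exact (hC' x hx hfx).trans (mul_le_mul_of_nonneg_right (le_max_right _ _) (abs_nonneg _))
  · intro p hp
    obtain ⟨C, hC⟩ : ∃ C : ℝ, ∀ᶠ x in 𝓝 p, f x < 0 → |h x| ≤ C * |f x| := by
      by_cases hfp : f p = 0
      · exact exists_abs_le_mul_abs_near hf hh hh0 hfp (hgrad p hfp)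
      · have hq : ContinuousAt (fun x => |h x| / |f x|) p :=
          (hh.continuous.abs.continuousAt).div hf.continuous.abs.continuousAt
            (abs_ne_zero.2 hfp)
        refine ⟨|h p| / |f p| + 1, ?_⟩
        filter_upwards [hq.eventually (gt_mem_nhds (lt_add_one _))] with x hx hfx
        exact (div_le_iff₀ (abs_pos.2 hfx.ne)).1 hx.le
    exact ⟨_, mem_nhdsWithin_of_mem_nhds hC, C, fun x hx => hx⟩

end BoundaryEstimate

lemma exists_abs_deriv_smoothTransition_le :
    ∃ M : ℝ, 0 ≤ M ∧ ∀ t, |deriv smoothTransition t| ≤ M ∧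
      (t < 0 ∨ 1 < t → deriv smoothTransition t = 0) := by
  have hc : Continuous (deriv smoothTransition) :=
    (smoothTransition.contDiff (n := 1)).continuous_deriv le_rfl
  have hz : ∀ t : ℝ, t < 0 ∨ 1 < t → deriv smoothTransition t = 0 := by
    rintro t (ht | ht)
    · have : smoothTransition =ᶠ[𝓝 t] fun _ => 0 := by
        filter_upwards [gt_mem_nhds ht] with s hs
        exact smoothTransition.zero_of_nonpos (le_of_lt hs)
      rw [this.deriv_eq, deriv_const]
    · have : smoothTransition =ᶠ[𝓝 t] fun _ => 1 := by
        filter_upwards [lt_mem_nhds ht] with s hs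
        exact smoothTransition.one_of_one_le (le_of_lt hs)
      rw [this.deriv_eq, deriv_const]
  obtain ⟨M, hM⟩ := (isCompact_Icc (a := (0 : ℝ)) (b := 1)).exists_bound_of_continuousOn
    hc.continuousOn
  have hM0 : 0 ≤ M := (norm_nonneg _).trans (hM 0 (by simp))
  refine ⟨M, hM0, fun t => ⟨?_, hz t⟩⟩
  by_cases ht : t ∈ Icc (0 : ℝ) 1
  · exact hM t ht
  · rw [hz t (by rw [mem_Icc] at ht; grind), abs_zero]
    exact hM0

/-- A superharmonic function with vanishing normal derivative is harmonic. -/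
lemma lap_eq_zero_of_nonpos {D : Set E₂} (hDo : IsOpen D) (hDb : Bornology.IsBounded D)
    {f u : E₂ → ℝ} (hf : ContDiff ℝ ∞ f) (hD : D = {x | f x < 0})
    (hfr : frontier D = {x | f x = 0}) (hgrad : ∀ x ∈ frontier D, gradient f x ≠ 0)
    (hu : ContDiff ℝ ∞ u) (hν : ∀ x ∈ frontier D, fderiv ℝ u x (gradient f x) = 0)
    (hlap : ∀ x ∈ D, lap u x ≤ 0) : ∀ x ∈ D, lap u x = 0 := by
  let k : E₂ → ℝ := fun x => ∑ i : Fin 2,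
    fderiv ℝ f x (EuclideanSpace.single i 1) * fderiv ℝ u x (EuclideanSpace.single i 1)
  have hk : ContDiff ℝ ∞ k := ContDiff.sum fun i _ =>
    (contDiff_fderiv_apply hf _).mul (contDiff_fderiv_apply hu _)
  obtain ⟨C, hC0, hC⟩ := exists_abs_le_mul_abs hDb hf hD hfr hgrad hk fun x hx => by
    rw [← hν x hx, fderiv_gradient_eq_sum]
  obtain ⟨M, hM0, hM⟩ := exists_abs_deriv_smoothTransition_le
  have hint : ∀ g : E₂ → ℝ, Continuous g → IntegrableOn g D := fun g hg =>
    (hg.continuousOn.integrableOn_compact hDb.isCompact_closure).mono_set subset_closure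
  let a : ℕ → E₂ → ℝ := fun n x => -((n : ℝ) + 1) * f x - 1
  have ha : ∀ n, ContDiff ℝ ∞ (a n) := fun n => (contDiff_const.mul hf).sub contDiff_const
  have hat : ∀ x ∈ D, Tendsto (fun n => a n x) atTop atTop := by
    intro x hx
    have hfx : f x < 0 := by rw [hD] at hx; exact hx
    have h1 : Tendsto (fun n : ℕ => (-f x) * ((n : ℝ) + 1) + (-1)) atTop atTop :=
      tendsto_atTop_add_const_right _ _ ((tendsto_atTop_add_const_right _ _
        tendsto_natCast_atTop_atTop).const_mul_atTop (by linarith))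
    refine h1.congr fun n => ?_
    simp only [a]
    ring
  let η : ℕ → E₂ → ℝ := fun n x => smoothTransition (a n x)
  have hη : ∀ n, ContDiff ℝ ∞ (η n) := fun n => smoothTransition.contDiff.comp (ha n)
  have hη0 : ∀ n, ∀ x ∈ frontier D, η n =ᶠ[𝓝 x] 0 := by
    intro n x hx
    have hfx : a n x < 0 := by
      rw [hfr] at hx
      have : f x = 0 := hx
      simp [a, this]
    filter_upwards [(ha n).continuous.continuousAt.eventually (gt_mem_nhds hfx)] with y hy
    exact smoothTransition.zero_of_nonpos hy.le
  let F : ℕ → E₂ → ℝ := fun n x => deriv smoothTransition (a n x) * -((n : ℝ) + 1) * k x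
  have hgreen : ∀ n, ∫ x in D, η n x * lap u x = -∫ x in D, F n x := by
    intro n
    have hs := tsupport_indicator_subset hDo (hη0 n)
    have := setIntegral_mul_lap (contDiff_indicator hDo (hη n) (hη0 n))
      (hasCompactSupport_of_tsupport_subset hDb hs) hs hu
    rw [setIntegral_congr_fun hDo.measurableSet (g := fun x => η n x * lap u x)
      fun x hx => by simp [indicator_of_mem hx]] at this
    rw [this, setIntegral_congr_fun hDo.measurableSet]
    intro x hx
    have hd : HasFDerivAt (η n)
        (deriv smoothTransition (a n x) • (-((n : ℝ) + 1)) • fderiv ℝ f x) x :=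
      ((smoothTransition.contDiff (n := 1)).differentiable (by simp) (a n x)).hasDerivAt
        |>.comp_hasFDerivAt x
        (((hf.differentiable (by simp) x).hasFDerivAt.const_mul _).sub_const 1)
    simp only [(indicator_eventuallyEq_self hDo hx).fderiv_eq, hd.fderiv, F, k, Finset.mul_sum]
    refine Finset.sum_congr rfl fun i _ => ?_
    simp only [_root_.smul_apply, smul_eq_mul]
    ring
  have hlim : Tendsto (fun n => ∫ x in D, η n x * lap u x) atTop (𝓝 (∫ x in D, lap u x)) := by
    refine tendsto_integral_of_dominated_convergence (fun x => |lap u x|)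
      (fun n => ((hη n).continuous.mul (continuous_lap hu)).aestronglyMeasurable)
      (hint _ (continuous_lap hu).abs) (fun n => ?_) ?_
    · refine Eventually.of_forall fun x => ?_
      rw [norm_mul, Real.norm_of_nonneg (smoothTransition.nonneg _), Real.norm_eq_abs]
      exact mul_le_of_le_one_left (abs_nonneg _) (smoothTransition.le_one _)
    · refine ae_restrict_of_forall_mem hDo.measurableSet fun x hx => ?_
      refine tendsto_const_nhds.congr' ?_
      filter_upwards [(hat x hx).eventually_ge_atTop 1] with n hn
      simp [η, smoothTransition.one_of_one_le hn]
  have hlimF : Tendsto (fun n => ∫ x in D, F n x) atTop (𝓝 (∫ _ in D, (0 : ℝ))) := by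
    refine tendsto_integral_of_dominated_convergence (fun _ => 2 * M * C) (fun n => ?_)
      (hint _ continuous_const) (fun n => ?_) ?_
    · have h1 : Continuous (deriv smoothTransition) :=
        (smoothTransition.contDiff (n := 1)).continuous_deriv le_rfl
      exact (((h1.comp (ha n).continuous).mul continuous_const).mul
        hk.continuous).aestronglyMeasurable
    · refine ae_restrict_of_forall_mem hDo.measurableSet fun x hx => ?_
      have hfx : f x < 0 := by rw [hD] at hx; exact hx
      by_cases h1 : 1 < a n x
      · simp only [F, (hM _).2 (Or.inr h1), zero_mul, norm_zero]
        positivity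
      · have h2 : ((n : ℝ) + 1) * |f x| ≤ 2 := by
          rw [abs_of_neg hfx]
          simp only [a] at h1
          linarith
        have hn : (0 : ℝ) ≤ (n : ℝ) + 1 := by positivity
        calc ‖F n x‖ = |deriv smoothTransition (a n x)| * ((n : ℝ) + 1) * |k x| := by
              simp only [F, norm_mul, norm_neg, Real.norm_eq_abs, abs_of_nonneg hn]
          _ ≤ M * ((n : ℝ) + 1) * (C * |f x|) := by
              gcongr
              exacts [(hM _).1, hC x hx]
          _ = M * C * (((n : ℝ) + 1) * |f x|) := by ring
          _ ≤ M * C * 2 := by gcongr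
          _ = 2 * M * C := by ring
    · refine ae_restrict_of_forall_mem hDo.measurableSet fun x hx => ?_
      refine tendsto_const_nhds.congr' ?_
      filter_upwards [(hat x hx).eventually_gt_atTop 1] with n hn
      simp [F, (hM _).2 (Or.inr hn)]
  have hzero : ∫ x in D, lap u x = 0 := by
    refine tendsto_nhds_unique hlim ?_
    simp only [hgreen]
    simpa using hlimF.neg
  intro x hx
  have := eqOn_zero_of_setIntegral_eq_zero hDo (g := fun x => -lap u x)
    (continuous_lap hu).neg.continuousOn (fun x hx => neg_nonneg.2 (hlap x hx))
    (hint _ (continuous_lap hu).neg) (by rw [integral_neg, hzero, neg_zero]) x hx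
  exact neg_eq_zero.1 this

section Eigenvalue

lemma lam1_nonneg (D : Set E₂) (w : E₂ → ℝ) : 0 ≤ lam1 D w := by
  refine Real.sInf_nonneg ?_
  rintro q ⟨φ, -, -, -, -, rfl⟩
  exact div_nonneg (integral_nonneg fun x => by positivity) (integral_nonneg fun x => by positivity)

lemma lam1_mul_le {D : Set E₂} {w φ : E₂ → ℝ} (hφ : ContDiff ℝ ∞ φ)
    (hφc : HasCompactSupport φ) (hφD : tsupport φ ⊆ D) :
    lam1 D w * ∫ x in D, Real.exp (2 * w x) * φ x ^ 2 ≤ ∫ x in D, ‖gradient φ x‖ ^ 2 := by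
  have hnum : 0 ≤ ∫ x in D, ‖gradient φ x‖ ^ 2 := integral_nonneg fun x => by positivity
  have hden : 0 ≤ ∫ x in D, Real.exp (2 * w x) * φ x ^ 2 :=
    integral_nonneg fun x => by positivity
  rcases hden.eq_or_lt with h0 | h0
  · rwa [← h0, mul_zero]
  · rw [← le_div_iff₀ h0]
    refine csInf_le ⟨0, ?_⟩ ⟨φ, hφ, hφc, hφD, ?_, rfl⟩
    · rintro q ⟨φ, -, -, -, -, rfl⟩
      exact div_nonneg (integral_nonneg fun x => by positivity)
        (integral_nonneg fun x => by positivity)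
    · rintro rfl
      simp at h0

/-- The weak maximum principle for `Δ + s e^{2w}` below the first Dirichlet eigenvalue. -/
lemma nonpos_of_lt_lam1 {D : Set E₂} (hDo : IsOpen D) (hDb : Bornology.IsBounded D)
    {w v : E₂ → ℝ} (hw : ContinuousOn w (closure D)) (hv : ContDiff ℝ ∞ v)
    (hv0 : ∀ x ∈ frontier D, v x = 0) {s : ℝ} (hs0 : 0 ≤ s) (hs : s < lam1 D w)
    (hsub : ∀ x ∈ D, 0 ≤ v x → -lap v x ≤ s * Real.exp (2 * w x) * v x) :
    ∀ x ∈ D, v x ≤ 0 := by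
  have hwe : ContinuousOn (fun x => Real.exp (2 * w x)) (closure D) :=
    Real.continuous_exp.comp_continuousOn (continuousOn_const.mul hw)
  have hint : ∀ g : E₂ → ℝ, ContinuousOn g (closure D) → IntegrableOn g D := fun g hg =>
    (hg.integrableOn_compact hDb.isCompact_closure).mono_set subset_closure
  have hvp : Continuous fun x => max (v x) 0 := hv.continuous.max continuous_const
  have hAi : IntegrableOn (fun x => Real.exp (2 * w x) * max (v x) 0 ^ 2) D :=
    hint _ (hwe.mul (hvp.pow 2).continuousOn)
  have hBi : IntegrableOn (fun x => Real.exp (2 * w x) * max (v x) 0) D :=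
    hint _ (hwe.mul hvp.continuousOn)
  set A := ∫ x in D, Real.exp (2 * w x) * max (v x) 0 ^ 2 with hA
  set B := ∫ x in D, Real.exp (2 * w x) * max (v x) 0 with hB
  have key : ∀ ε : ℝ, 0 < ε → lam1 D w * (A - 4 * ε * B) ≤ s * A := by
    intro ε hε
    obtain ⟨G, H, g, hG, hH, hGd, hHd, hGε, hHε, hG0, hG1, hH0, hH1⟩ :=
      exists_smooth_truncation hε
    have hvan : ∀ P : ℝ → ℝ, (∀ s ≤ ε, P s = 0) →
        ∀ x ∈ frontier D, (fun y => P (v y)) =ᶠ[𝓝 x] 0 := by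
      intro P hP x hx
      filter_upwards [hv.continuous.continuousAt.eventually
        (gt_mem_nhds ((hv0 x hx).trans_lt hε))] with y hy
      exact hP _ hy.le
    have hGs := tsupport_indicator_subset hDo (hvan G hGε)
    have hHs := tsupport_indicator_subset hDo (hvan H hHε)
    have hray := lam1_mul_le (w := w) (contDiff_indicator hDo (hG.comp hv) (hvan G hGε))
      (hasCompactSupport_of_tsupport_subset hDb hGs) hGs
    have hgreen := setIntegral_mul_lap (contDiff_indicator hDo (hH.comp hv) (hvan H hHε))
      (hasCompactSupport_of_tsupport_subset hDb hHs) hHs hv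
    have hfd : ∀ (P : ℝ → ℝ) (p : ℝ) (x : E₂), x ∈ D → HasDerivAt P p (v x) →
        fderiv ℝ (D.indicator fun y => P (v y)) x = p • fderiv ℝ v x := by
      intro P p x hx hP
      rw [(indicator_eventuallyEq_self hDo hx).fderiv_eq]
      exact (hP.comp_hasFDerivAt x (hv.differentiable (by simp) x).hasFDerivAt).fderiv
    have hgrad : ∫ x in D, ‖gradient (D.indicator fun y => G (v y)) x‖ ^ 2 =
        ∫ x in D, -(H (v x) * lap v x) := by
      rw [setIntegral_congr_fun hDo.measurableSet (g := fun x => H (v x) * lap v x)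
        fun x hx => by simp [indicator_of_mem hx]] at hgreen
      rw [integral_neg, hgreen, neg_neg]
      refine setIntegral_congr_fun hDo.measurableSet fun x hx => ?_
      simp only [norm_gradient_sq]
      refine Finset.sum_congr rfl fun i _ => ?_
      have h1 := hfd G _ x hx (hGd _)
      have h2 := hfd H _ x hx (hHd _)
      simp only [Function.comp_def, h1, h2, _root_.smul_apply, smul_eq_mul]
      ring
    have hupper : ∫ x in D, -(H (v x) * lap v x) ≤ s * A := by
      rw [hA, ← integral_const_mul]
      refine setIntegral_mono_on
        (hint _ ((hH.continuous.comp hv.continuous).mul (continuous_lap hv)).neg.continuousOn)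
        (hAi.const_mul s) hDo.measurableSet fun x hx => ?_
      rcases le_total (v x) 0 with h | h
      · rw [hHε _ (h.trans hε.le), zero_mul, neg_zero]
        positivity
      · have h1 := hsub x hx h
        have h2 := hH1 (v x)
        rw [max_eq_left h] at h2 ⊢
        calc -(H (v x) * lap v x) = H (v x) * -lap v x := by ring
          _ ≤ H (v x) * (s * Real.exp (2 * w x) * v x) :=
              mul_le_mul_of_nonneg_left h1 (hH0 _)
          _ ≤ v x * (s * Real.exp (2 * w x) * v x) :=
              mul_le_mul_of_nonneg_right h2 (by positivity)
          _ = s * (Real.exp (2 * w x) * v x ^ 2) := by ring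
    have hlower : A - 4 * ε * B ≤
        ∫ x in D, Real.exp (2 * w x) * (D.indicator (fun y => G (v y)) x) ^ 2 := by
      rw [setIntegral_congr_fun hDo.measurableSet
        (g := fun x => Real.exp (2 * w x) * G (v x) ^ 2)
        fun x hx => by simp [indicator_of_mem hx], hA, hB, ← integral_const_mul,
        ← integral_sub hAi (hBi.const_mul _)]
      refine setIntegral_mono_on (hAi.sub (hBi.const_mul _))
        (hint _ (hwe.mul ((hG.continuous.comp hv.continuous).pow 2).continuousOn))
        hDo.measurableSet fun x _ => ?_
      have hsq : max (v x) 0 ^ 2 - 4 * ε * max (v x) 0 ≤ G (v x) ^ 2 := by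
        have h1 := hG1 (v x)
        have h0 := hG0 (v x)
        rcases le_total (v x) 0 with h | h
        · rw [max_eq_right h]
          nlinarith
        · rw [max_eq_left h]
          rcases le_total (v x) (2 * ε) with h' | h' <;> nlinarith
      calc _ = Real.exp (2 * w x) * (max (v x) 0 ^ 2 - 4 * ε * max (v x) 0) := by ring
        _ ≤ _ := mul_le_mul_of_nonneg_left hsq (Real.exp_pos _).le
    calc lam1 D w * (A - 4 * ε * B) ≤ _ := mul_le_mul_of_nonneg_left hlower (lam1_nonneg D w)
      _ ≤ _ := hray
      _ = _ := hgrad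
      _ ≤ s * A := hupper
  have hlim : lam1 D w * A ≤ s * A := by
    have ht : Tendsto (fun ε : ℝ => lam1 D w * (A - 4 * ε * B)) (𝓝[>] 0)
        (𝓝 (lam1 D w * A)) := by
      have : Continuous fun ε : ℝ => lam1 D w * (A - 4 * ε * B) := by fun_prop
      simpa using (this.tendsto 0).mono_left nhdsWithin_le_nhds
    exact le_of_tendsto ht (by filter_upwards [self_mem_nhdsWithin] with ε hε using key ε hε)
  have hA0 : 0 ≤ A := integral_nonneg fun x => by positivity
  have hAz : A = 0 := by nlinarith
  intro x hx
  have hz := eqOn_zero_of_setIntegral_eq_zero hDo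
    (g := fun x => Real.exp (2 * w x) * max (v x) 0 ^ 2)
    ((hwe.mul (hvp.pow 2).continuousOn).mono subset_closure)
    (fun x _ => by positivity) hAi hAz x hx
  have : max (v x) 0 = 0 := by
    simpa [Real.exp_ne_zero] using hz
  exact max_eq_right_iff.1 this

end Eigenvalue

/-- Two-dimensional conformally flat case of Theorem 2.2: if `R[w] = -2e^{-2w}Δw > 0`
on `closure D`, `λ₁(D,w) > sup_D R[w]`, the scalar curvature of `e^{2(w+u)}·δ`
dominates that of `e^{2w}·δ` on `D`, `u = 0` on `∂D` and `∂u/∂ν = 0` on `∂D`,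
then `u ≡ 0` on `D`. -/
theorem stmt_10
    (D : Set (EuclideanSpace ℝ (Fin 2))) (hDo : IsOpen D)
    (hDb : Bornology.IsBounded D)
    (ν : EuclideanSpace ℝ (Fin 2) → EuclideanSpace ℝ (Fin 2))
    (hsb : SmoothBoundaryNormal D ν)
    (w : EuclideanSpace ℝ (Fin 2) → ℝ)
    (U : Set (EuclideanSpace ℝ (Fin 2)))
    (hU : IsOpen U) (hUc : closure D ⊆ U)
    (hw : ContDiffOn ℝ (⊤ : ℕ∞) w U)
    (hRpos : ∀ x ∈ closure D, 0 < Rcurv2 w x)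
    (hlam : sSup ((fun x => Rcurv2 w x) '' D) < lam1 D w)
    (u : EuclideanSpace ℝ (Fin 2) → ℝ)
    (V : Set (EuclideanSpace ℝ (Fin 2)))
    (hV : IsOpen V) (hVc : closure D ⊆ V)
    (hu : ContDiffOn ℝ (⊤ : ℕ∞) u V)
    (hcurv : ∀ x ∈ D, Rcurv2 w x ≤ Rcurv2 (fun y => w y + u y) x)
    (hbd1 : ∀ x ∈ frontier D, u x = 0)
    (hbd2 : ∀ x ∈ frontier D, fderiv ℝ u x (ν x) = 0) :
    ∀ x ∈ D, u x = 0 := by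
  obtain ⟨f, hf, hD, hfr, hfν⟩ := hsb
  obtain ⟨W, hW, hWw⟩ := exists_contDiff_eventuallyEq isClosed_closure hU hUc hw
  obtain ⟨v, hv, hvu⟩ := exists_contDiff_eventuallyEq isClosed_closure hV hVc hu
  have hfrc : frontier D ⊆ closure D := frontier_subset_closure
  have hRw : ∀ x ∈ closure D, Rcurv2 w x = Rcurv2 W x := fun x hx => by
    rw [Rcurv2, Rcurv2, lap_congr (hWw x hx), (hWw x hx).self_of_nhds]
  have hRWc : Continuous (Rcurv2 W) := by
    have h1 := continuous_lap hW
    have h2 := hW.continuous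
    unfold Rcurv2
    fun_prop
  have hbdd : BddAbove ((fun x => Rcurv2 w x) '' D) := by
    refine (hDb.isCompact_closure.bddAbove_image hRWc.continuousOn).mono ?_
    rintro _ ⟨x, hx, rfl⟩
    exact ⟨x, subset_closure hx, (hRw x (subset_closure hx)).symm⟩
  have hle : ∀ x ∈ D, Rcurv2 w x ≤ sSup ((fun x => Rcurv2 w x) '' D) := fun x hx =>
    le_csSup hbdd ⟨x, hx, rfl⟩
  have hs0 : 0 ≤ sSup ((fun x => Rcurv2 w x) '' D) := by
    refine Real.sSup_nonneg ?_
    rintro _ ⟨x, hx, rfl⟩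
    exact (hRpos x (subset_closure hx)).le
  -- The curvature inequality, linearised through `e^{2v} - 1 ≥ 2v`.
  have hlin : ∀ x ∈ D, Rcurv2 w x * Real.exp (2 * w x) * v x ≤ -lap v x := by
    intro x hx
    have hxc := subset_closure hx
    have h1 := hcurv x hx
    have hsum : (fun y => w y + u y) =ᶠ[𝓝 x] fun y => W y + v y := by
      filter_upwards [hWw x hxc, hvu x hxc] with y hy1 hy2
      rw [hy1, hy2]
    have hv2 : v x = u x := (hvu x hxc).self_of_nhds
    have hw2 := Rcurv2_mul_exp w x
    have hwu := Rcurv2_mul_exp (fun y => w y + u y) x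
    rw [lap_congr hsum, lap_add hW hv, ← hv2, mul_add, Real.exp_add] at hwu
    rw [← lap_congr (hWw x hxc)] at hw2
    have h2 := mul_le_mul_of_nonneg_right h1
      (by positivity : 0 ≤ Real.exp (2 * w x) * Real.exp (2 * v x))
    have hpos : 0 < Rcurv2 w x * Real.exp (2 * w x) := mul_pos (hRpos x hxc) (Real.exp_pos _)
    have h3 := mul_le_mul_of_nonneg_left (Real.add_one_le_exp (2 * v x)) hpos.le
    linarith
  have hneg : ∀ x ∈ D, -v x ≤ 0 := by
    refine nonpos_of_lt_lam1 hDo hDb (hw.continuousOn.mono hUc) hv.neg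
      (fun x hx => ?_) hs0 hlam fun x hx hvx => ?_
    · rw [(hvu x (hfrc hx)).self_of_nhds, hbd1 x hx, neg_zero]
    · rw [lap_neg, neg_neg]
      have h1 := mul_le_mul_of_nonneg_right (hle x hx)
        (mul_nonneg (Real.exp_pos (2 * w x)).le hvx)
      linarith [hlin x hx]
  have hνv : ∀ x ∈ frontier D, fderiv ℝ v x (gradient f x) = 0 := by
    intro x hx
    have h1 := hbd2 x hx
    rw [(hfν x hx).2, map_smul, smul_eq_mul, mul_eq_zero] at h1
    rw [(hvu x (hfrc hx)).fderiv_eq]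
    exact h1.resolve_left (inv_ne_zero (norm_ne_zero_iff.2 (hfν x hx).1))
  have hRe : ∀ x ∈ D, 0 < Rcurv2 w x * Real.exp (2 * w x) := fun x hx =>
    mul_pos (hRpos x (subset_closure hx)) (Real.exp_pos _)
  have hharm := lap_eq_zero_of_nonpos hDo hDb hf hD hfr (fun x hx => (hfν x hx).1) hv hνv
    fun x hx => by
      have := mul_nonneg (hRe x hx).le (neg_nonpos.1 (hneg x hx))
      linarith [hlin x hx]
  intro x hx
  have h1 := hlin x hx
  rw [hharm x hx, neg_zero] at h1
  rw [← (hvu x (subset_closure hx)).self_of_nhds]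
  exact le_antisymm (nonpos_of_mul_nonpos_right h1 (hRe x hx)) (neg_nonpos.1 (hneg x hx))
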